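/- arXiv:2505.11113 — 2 statements merged into one kernel-verified Lean document; each statement's English description precedes it below -/
import Mathlib

section
/- There exists a constant C = C(N,R) > 0, depending only on the dimension N and on R, such that for every φ ∈ C_c^∞(ℝ^N) one has (1/C) ∫_{ℝ^N} |φ|² dx ≤ ∫_{ℝ^N} |∇φ|² dx + ∫_{ℝ^N} V|φ|² dx. -/
open MeasureTheory Metric

lemma Continuous.integrable_mul_of_hasCompactSupport {X : Type*} [TopologicalSpace X]
    [MeasurableSpace X] [OpensMeasurableSpace X] {μ : Measure X} [IsFiniteMeasureOnCompacts μ]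
    {f g : X → ℝ} (hf : Continuous f) (hg : Continuous g) (hc : HasCompactSupport g) :
    Integrable (fun x => f x * g x) μ :=
  (hf.mul hg).integrable_of_hasCompactSupport hc.mul_left

/-- Integration by parts against the linear weight `⟪e, ·⟫`, for a unit vector `e`. -/
lemma integral_sq_eq_neg_integral_inner_mul {E : Type*} [NormedAddCommGroup E]
    [InnerProductSpace ℝ E] [FiniteDimensional ℝ E] [MeasurableSpace E] [BorelSpace E]
    {e : E} (he : ‖e‖ = 1) {φ : E → ℝ} (hφ : ContDiff ℝ 1 φ) (hc : HasCompactSupport φ) :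
    ∫ x, φ x ^ 2 = -∫ x, inner ℝ e x * (2 * φ x * fderiv ℝ φ x e) := by
  have hdφ : Differentiable ℝ φ := hφ.differentiable one_ne_zero
  have hφ' : Continuous fun x => fderiv ℝ φ x e :=
    (hφ.continuous_fderiv one_ne_zero).clm_apply continuous_const
  have hφc : Continuous φ := hφ.continuous
  have hsq : ∀ x, fderiv ℝ (fun y => φ y ^ 2) x e = 2 * φ x * fderiv ℝ φ x e := fun x => by
    simp [((hdφ x).hasFDerivAt.pow 2).fderiv]
  have hlin : ∀ x, fderiv ℝ (fun y => inner ℝ e y) x e = 1 := fun x => by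
    have h : fderiv ℝ (fun y => inner ℝ e y) x = innerSL ℝ e :=
      (innerSL ℝ e).hasFDerivAt.fderiv
    simp [h, he]
  have hmul : ∀ f : E → ℝ, Continuous f → Integrable fun x => f x * φ x := fun f hf =>
    hf.integrable_mul_of_hasCompactSupport hφc hc
  have h := integral_mul_fderiv_eq_neg_fderiv_mul_of_integrable (μ := volume)
    (f := fun y : E => inner ℝ e y) (g := fun y => φ y ^ 2) (v := e)
    (by simpa only [hlin, one_mul, sq] using hmul φ hφc)
    (by
      simp only [hsq]
      refine (hmul (fun x => inner ℝ e x * (2 * fderiv ℝ φ x e)) (by fun_prop)).congr ?_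
      exact .of_forall fun x => by ring)
    (by
      refine (hmul (fun x => inner ℝ e x * φ x) (by fun_prop)).congr ?_
      exact .of_forall fun x => by ring)
    (fun x _ => (innerSL ℝ e).differentiableAt) (fun x _ => (hdφ x).pow 2)
  simp only [hsq, hlin, one_mul] at h
  rw [h, neg_neg]

lemma neg_mul_two_mul_mul_le {a d t r G V : ℝ} (ha : a ^ 2 ≤ 2 * (r ^ 2 + V)) (hd : d ^ 2 ≤ G)
    (hV : 0 ≤ V) :
    -(a * (2 * t * d)) ≤ 4 * (r ^ 2 + 1) * G + (2⁻¹ * t ^ 2 + V * t ^ 2) := by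
  set K := 4 * (r ^ 2 + 1) with hK
  have hK0 : 0 < K := by positivity
  have haK : a ^ 2 ≤ K * (2⁻¹ + V) := by nlinarith [mul_nonneg (sq_nonneg r) hV]
  have h1 : a ^ 2 * t ^ 2 ≤ K * (2⁻¹ + V) * t ^ 2 := by gcongr
  have h2 : K ^ 2 * d ^ 2 ≤ K ^ 2 * G := by gcongr
  refine le_of_mul_le_mul_left ?_ hK0
  linarith [sq_nonneg (a * t + K * d)]

/-- Poincaré-type inequality: there is a constant `C = C(N,R) > 0`, depending only on
the dimension `N` and on `R = max_{x∈Σ}|x|`, such that for every `φ ∈ C_c^∞(ℝ^N)`,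
`(1/C) ∫ |φ|² ≤ ∫ |∇φ|² + ∫ V |φ|²`. -/
theorem poincare_inequality (N : ℕ) (hN : 1 ≤ N) (R : ℝ) :
    ∃ C : ℝ, 0 < C ∧
      ∀ S : Set (EuclideanSpace ℝ (Fin N)), S.Nonempty → IsCompact S →
        IsGreatest ((fun x => ‖x‖) '' S) R →
        ∀ φ : EuclideanSpace ℝ (Fin N) → ℝ, ContDiff ℝ (⊤ : ℕ∞) φ → HasCompactSupport φ →
          (1 / C) * ∫ x, (φ x) ^ 2 ≤
            (∫ x, ‖gradient φ x‖ ^ 2) +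
              ∫ x, (Metric.infDist x S) ^ 2 * (φ x) ^ 2 := by
  refine ⟨8 * (R ^ 2 + 1), by positivity, fun S hne hS hR φ hφ hc => ?_⟩
  set e : EuclideanSpace ℝ (Fin N) := EuclideanSpace.single ⟨0, hN⟩ 1
  have he : ‖e‖ = 1 := by simp [e]
  have hφ1 : ContDiff ℝ 1 φ := hφ.of_le (by exact_mod_cast le_top)
  have hφc : Continuous φ := hφ.continuous
  have hgrad : Continuous (gradient φ) :=
    (InnerProductSpace.toDual ℝ _).symm.continuous.comp (hφ1.continuous_fderiv one_ne_zero)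
  have hgc : HasCompactSupport (gradient φ) :=
    (hc.fderiv ℝ).comp_left (map_zero (InnerProductSpace.toDual ℝ _).symm)
  have hmul : ∀ f : EuclideanSpace ℝ (Fin N) → ℝ, Continuous f →
      Integrable fun x => f x * φ x ^ 2 := fun f hf => by
    have hw : Continuous fun x => f x * φ x := hf.mul hφc
    exact (hw.integrable_mul_of_hasCompactSupport hφc hc).congr (.of_forall fun x => by ring)
  have hI : Integrable fun x => φ x ^ 2 := by
    simpa using hmul (fun _ => 1) continuous_const
  have hV : Integrable fun x => infDist x S ^ 2 * φ x ^ 2 :=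
    hmul _ ((continuous_infDist_pt S).pow 2)
  have hG : Integrable fun x => ‖gradient φ x‖ ^ 2 := by
    simpa only [sq] using
      hgrad.norm.integrable_mul_of_hasCompactSupport (μ := volume) hgrad.norm hgc.norm
  have hφ' : Continuous fun x => fderiv ℝ φ x e :=
    (hφ1.continuous_fderiv one_ne_zero).clm_apply continuous_const
  have hD : Integrable fun x => inner ℝ e x * (2 * φ x * fderiv ℝ φ x e) := by
    have hw : Continuous fun x => 2 * inner ℝ e x * fderiv ℝ φ x e := by fun_prop
    exact (hw.integrable_mul_of_hasCompactSupport hφc hc).congr (.of_forall fun x => by ring)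
  have hnorm : ∀ x, ‖x‖ ≤ R + infDist x S := fun x => by
    obtain ⟨y, hy, hxy⟩ := hS.exists_infDist_eq_dist hne x
    have hyR : ‖y‖ ≤ R := hR.2 ⟨y, hy, rfl⟩
    rw [hxy, dist_eq_norm]
    linarith [norm_le_norm_add_norm_sub' x y]
  have hpt : ∀ x, -(inner ℝ e x * (2 * φ x * fderiv ℝ φ x e)) ≤
      4 * (R ^ 2 + 1) * ‖gradient φ x‖ ^ 2 +
        (2⁻¹ * φ x ^ 2 + infDist x S ^ 2 * φ x ^ 2) := fun x => by
    have hin : |inner ℝ e x| ≤ R + infDist x S := by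
      refine le_trans ?_ (hnorm x)
      simpa only [he, one_mul] using abs_real_inner_le_norm e x
    have hder : |fderiv ℝ φ x e| ≤ ‖gradient φ x‖ := by
      rw [← inner_gradient_left]
      simpa [he] using abs_real_inner_le_norm (gradient φ x) e
    have hin2 : inner ℝ e x ^ 2 ≤ 2 * (R ^ 2 + infDist x S ^ 2) := by
      have := sq_le_sq' (abs_le.1 hin).1 (abs_le.1 hin).2
      nlinarith [sq_nonneg (R - infDist x S)]
    have hder2 : fderiv ℝ φ x e ^ 2 ≤ ‖gradient φ x‖ ^ 2 :=
      sq_le_sq' (abs_le.1 hder).1 (abs_le.1 hder).2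
    exact neg_mul_two_mul_mul_le hin2 hder2 (sq_nonneg _)
  have hmain := integral_sq_eq_neg_integral_inner_mul he hφ1 hc
  have hle : ∫ x, φ x ^ 2 ≤ 4 * (R ^ 2 + 1) * (∫ x, ‖gradient φ x‖ ^ 2) +
      (2⁻¹ * (∫ x, φ x ^ 2) + ∫ x, infDist x S ^ 2 * φ x ^ 2) :=
    calc ∫ x, φ x ^ 2 = ∫ x, -(inner ℝ e x * (2 * φ x * fderiv ℝ φ x e)) := by
          rw [hmain, integral_neg]
      _ ≤ ∫ x, (4 * (R ^ 2 + 1) * ‖gradient φ x‖ ^ 2 +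
          (2⁻¹ * φ x ^ 2 + infDist x S ^ 2 * φ x ^ 2)) :=
          integral_mono hD.neg ((hG.const_mul _).add ((hI.const_mul _).add hV)) hpt
      _ = _ := by
          rw [integral_add (hG.const_mul _) (by exact (hI.const_mul _).add hV),
            integral_add (hI.const_mul _) hV, integral_const_mul, integral_const_mul]
  have hV0 : 0 ≤ ∫ x, infDist x S ^ 2 * φ x ^ 2 := integral_nonneg fun x => by positivity
  rw [one_div_mul_eq_div, div_le_iff₀ (by positivity)]
  nlinarith [mul_nonneg (sq_nonneg R) hV0]
end

section
/- Let N = 3 and, for R > 0, let Σ = S_R = {(x₁,x₂,x₃) ∈ ℝ³ : x₁² + x₂² = R², x₃ = 0} be the circle of radius R in the plane {x₃ = 0}, with potential V(x) = (dist(x,Σ))². Then there exists a universal constant β > 0, independent of R, such that for every R > 0 and every φ ∈ C_c^∞(ℝ³) one has β ∫_{ℝ³} |φ|² dx ≤ ∫_{ℝ³} |∇φ|² dx + ∫_{ℝ³} V|φ|² dx; in particular the ground state energy λ₁(V) is bounded below by β uniformly in R. -/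
open MeasureTheory Metric

/-- The distance from `x` to a nonempty subset of the hyperplane `{y i = 0}` is at least `|x i|`. -/
lemma abs_apply_le_infDist_of_forall_eq_zero {ι : Type*} [Fintype ι] (i : ι)
    {s : Set (EuclideanSpace ℝ ι)} (hs : s.Nonempty) (h : ∀ y ∈ s, y i = 0)
    (x : EuclideanSpace ℝ ι) : |x i| ≤ infDist x s := by
  refine (le_infDist hs).2 fun y hy ↦ ?_
  have := PiLp.norm_apply_le (x - y) i
  rw [dist_eq_norm]
  simpa [h y hy] using this

lemma norm_gradient_eq_norm_fderiv {E : Type*} [NormedAddCommGroup E] [InnerProductSpace ℝ E]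
    [CompleteSpace E] (f : E → ℝ) (x : E) : ‖gradient f x‖ = ‖fderiv ℝ f x‖ := by
  simp [gradient]

/-- The ground state bound of the one-dimensional harmonic oscillator, in the coordinate `i`, for
any weight `w` dominating `x i ^ 2`. -/
lemma integral_sq_le_integral_gradient_add_integral_mul {ι : Type*} [Fintype ι] (i : ι)
    {φ w : EuclideanSpace ℝ ι → ℝ} (hφ : ContDiff ℝ 1 φ) (hc : HasCompactSupport φ)
    (hw : Continuous w) (hle : ∀ x, x i ^ 2 ≤ w x) :
    ∫ x, φ x ^ 2 ≤ (∫ x, ‖gradient φ x‖ ^ 2) + ∫ x, w x * φ x ^ 2 := by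
  classical
  set e : EuclideanSpace ℝ ι := EuclideanSpace.single i 1 with he
  have hdiff : Differentiable ℝ φ := hφ.differentiable one_ne_zero
  have hφc : Continuous φ := hφ.continuous
  have hDφ : Continuous (fderiv ℝ φ) := hφ.continuous_fderiv one_ne_zero
  have hD : Continuous fun x ↦ fderiv ℝ φ x e := hDφ.clm_apply continuous_const
  have hcoord : Continuous fun x : EuclideanSpace ℝ ι ↦ x i := by fun_prop
  have hmul : ∀ f : EuclideanSpace ℝ ι → ℝ, Continuous f → Integrable fun x ↦ f x * φ x :=
    fun f hf ↦ (hf.mul hφc).integrable_of_hasCompactSupport hc.mul_left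
  have hderiv : ∀ x, fderiv ℝ (fun x ↦ x i * φ x) x e = φ x + x i * fderiv ℝ φ x e := by
    intro x
    have h1 : HasFDerivAt (fun x : EuclideanSpace ℝ ι ↦ x i)
        (EuclideanSpace.proj i : EuclideanSpace ℝ ι →L[ℝ] ℝ) x :=
      (EuclideanSpace.proj i : EuclideanSpace ℝ ι →L[ℝ] ℝ).hasFDerivAt
    have h2 : HasFDerivAt (fun x ↦ x i * φ x) _ x := h1.mul (hdiff x).hasFDerivAt
    rw [h2.fderiv]
    simp [he]
    ring
  have hint1 : Integrable fun x ↦ φ x * (φ x + x i * fderiv ℝ φ x e) :=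
    (hmul _ (hφc.add (hcoord.mul hD))).congr (.of_forall fun x ↦ mul_comm _ _)
  have hint2 : Integrable fun x ↦ fderiv ℝ φ x e * (x i * φ x) :=
    (hmul _ (hD.mul hcoord)).congr (.of_forall fun x ↦ mul_assoc _ _ _)
  have hint3 : Integrable fun x ↦ φ x * (x i * φ x) :=
    (hmul _ (hφc.mul hcoord)).congr (.of_forall fun x ↦ mul_assoc _ _ _)
  have hparts : ∫ x, φ x * (φ x + x i * fderiv ℝ φ x e)
      = -∫ x, fderiv ℝ φ x e * (x i * φ x) := by
    have := integral_mul_fderiv_eq_neg_fderiv_mul_of_integrable (μ := volume) (𝕜 := ℝ)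
      (f := φ) (g := fun x ↦ x i * φ x) (v := e) hint2
      (by simpa only [hderiv] using hint1) hint3 (fun x _ ↦ hdiff x) (fun x _ ↦ by fun_prop)
    simpa only [hderiv] using this
  have hgrad : Integrable fun x ↦ ‖gradient φ x‖ ^ 2 := by
    simp only [norm_gradient_eq_norm_fderiv]
    have hs : HasCompactSupport fun x ↦ ‖fderiv ℝ φ x‖ ^ 2 :=
      (hc.fderiv (𝕜 := ℝ)).norm.comp_left (g := fun t : ℝ ↦ t ^ 2) (zero_pow two_ne_zero)
    exact (hDφ.norm.pow 2).integrable_of_hasCompactSupport hs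
  have hpot : Integrable fun x ↦ w x * φ x ^ 2 :=
    (hmul _ (hw.mul hφc)).congr (.of_forall fun x ↦ by simp only [Pi.mul_apply]; ring)
  have hsq : Integrable fun x ↦ φ x ^ 2 :=
    (hmul _ hφc).congr (.of_forall fun x ↦ by ring)
  have hint : Integrable fun x ↦ φ x * (φ x + x i * fderiv ℝ φ x e)
      + fderiv ℝ φ x e * (x i * φ x) := hint1.add hint2
  have henergy : Integrable fun x ↦ ‖gradient φ x‖ ^ 2 + w x * φ x ^ 2 := hgrad.add hpot
  have hmono : ∫ x, φ x ^ 2 ≤ ∫ x, ((φ x * (φ x + x i * fderiv ℝ φ x e)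
      + fderiv ℝ φ x e * (x i * φ x)) + (‖gradient φ x‖ ^ 2 + w x * φ x ^ 2)) := by
    refine integral_mono hsq (hint.add henergy) fun x ↦ ?_
    have h1 : fderiv ℝ φ x e ^ 2 ≤ ‖gradient φ x‖ ^ 2 := by
      rw [norm_gradient_eq_norm_fderiv, sq_le_sq, abs_of_nonneg (norm_nonneg _)]
      simpa [he] using (fderiv ℝ φ x).le_opNorm e
    have h2 := mul_le_mul_of_nonneg_right (hle x) (sq_nonneg (φ x))
    dsimp only
    nlinarith [sq_nonneg (fderiv ℝ φ x e + x i * φ x)]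
  rw [integral_add hint henergy, integral_add hint1 hint2,
    integral_add hgrad hpot, hparts] at hmono
  linarith

/-- Uniform lower bound for the ground state energy with the circle `S_R ⊆ ℝ³` as
potential well: there is a universal constant `β > 0`, independent of `R`, such that
for every `R > 0` and every `φ ∈ C_c^∞(ℝ³)`,
`β ∫ |φ|² ≤ ∫ |∇φ|² + ∫ V |φ|²`, where `V(x) = dist(x, S_R)²`. In particular
`λ₁(V) ≥ β` for every `R > 0`. -/
theorem circle_uniform_ground_state_bound :
    ∃ β : ℝ, 0 < β ∧
      ∀ R : ℝ, 0 < R →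
        ∀ φ : EuclideanSpace ℝ (Fin 3) → ℝ, ContDiff ℝ (⊤ : ℕ∞) φ → HasCompactSupport φ →
          β * ∫ x, (φ x) ^ 2 ≤
            (∫ x, ‖gradient φ x‖ ^ 2) +
              ∫ x, (Metric.infDist x
                  {y : EuclideanSpace ℝ (Fin 3) |
                    (y 0) ^ 2 + (y 1) ^ 2 = R ^ 2 ∧ y 2 = 0}) ^ 2 * (φ x) ^ 2 := by
  refine ⟨1, one_pos, fun R _ φ hφ hc ↦ ?_⟩
  rw [one_mul]
  refine integral_sq_le_integral_gradient_add_integral_mul 2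
    (hφ.of_le (by exact_mod_cast le_top)) hc ((continuous_infDist_pt _).pow 2) fun x ↦ ?_
  rw [sq_le_sq, abs_of_nonneg infDist_nonneg]
  exact abs_apply_le_infDist_of_forall_eq_zero 2 ⟨!₂[R, 0, 0], by simp⟩ (fun y hy ↦ hy.2) x
end
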